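/- (Proposition 2) Let d ≥ 2, n = d+1, and fix nonnegative integers ℓ₁, ℓ₂ with ℓ := ℓ₁+ℓ₂ < d and ℓ₁ ≤ ℓ₂. For any symmetrical code that satisfies node regeneration, one has H(S_{ℓ₁+1→[1:ℓ₁]}) + (ℓ₁/(d−ℓ)) · H(U^{(ℓ₁,ℓ)}) ≥ (ℓ₁/(d−ℓ)) · H(U^{(ℓ₁,ℓ+1)}). -/

import Mathlib

open scoped BigOperators Classical

namespace MDCSR

noncomputable section

/-- `X` is a deterministic function of `Y`. -/
def IsFuncOf {Ω α β : Type*} (X : Ω → α) (Y : Ω → β) : Prop :=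
  ∃ f : β → α, ∀ ω, X ω = f (Y ω)

variable {Ω V : Type} [Fintype Ω]

/-- Probability of the event `X = x` under the probability mass function `p`. -/
def pm (p : Ω → ℝ) {α : Type*} (X : Ω → α) (x : α) : ℝ :=
  ∑ ω ∈ Finset.univ.filter (fun ω' => X ω' = x), p ω

/-- Shannon entropy of the random variable `X` under the probability mass function `p`. -/
def H (p : Ω → ℝ) {α : Type*} (X : Ω → α) : ℝ :=
  -∑ ω, p ω * Real.log (pm p X (X ω))

/-- An `(n = d+1, d)` code: messages `M 1, …, M d`, a key `K`, node contents
`W 1, …, W (d+1)`, and repair data `S i j` (data downloaded from node `i` to repair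
node `j`), all random variables on a common finite probability space `(Ω, p)`.
The messages are mutually independent, the key is independent of the messages,
each `W i` is a deterministic function of the messages and the key, and each
`S i j` is a deterministic function of `W i`. -/
structure Code (Ω V : Type) [Fintype Ω] (d : ℕ) : Type where
  p : Ω → ℝ
  p_nonneg : ∀ ω, 0 ≤ p ω
  p_sum : ∑ ω, p ω = 1
  M : ℕ → Ω → V
  K : Ω → V
  W : ℕ → Ω → V
  S : ℕ → ℕ → Ω → V
  M_indep : ∀ x : ℕ → V,
    pm p (fun ω (i : Fin d) => M (↑i + 1) ω) (fun i => x (↑i + 1)) =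
      ∏ i ∈ Finset.Icc 1 d, pm p (M i) (x i)
  K_indep : ∀ (k : V) (x : ℕ → V),
    pm p (fun ω => (K ω, fun (i : Fin d) => M (↑i + 1) ω)) (k, fun i => x (↑i + 1)) =
      pm p K k * pm p (fun ω (i : Fin d) => M (↑i + 1) ω) (fun i => x (↑i + 1))
  W_func : ∀ i ∈ Finset.Icc 1 (d + 1),
    IsFuncOf (W i) (fun ω => ((fun (j : Fin d) => M (↑j + 1) ω), K ω))
  S_func : ∀ i ∈ Finset.Icc 1 (d + 1), ∀ j ∈ Finset.Icc 1 (d + 1), i ≠ j →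
    IsFuncOf (S i j) (W i)

/-- Descriptors for the basic random variables of a code. -/
inductive Atom where
  | M : ℕ → Atom
  | K : Atom
  | W : ℕ → Atom
  | S : ℕ → ℕ → Atom

variable {d : ℕ}

/-- The random variable described by an atom. -/
def Code.atomRV (C : Code Ω V d) : Atom → Ω → V
  | .M i => C.M i
  | .K => C.K
  | .W i => C.W i
  | .S i j => C.S i j

/-- The joint random variable (tuple) described by a list of atoms. -/
def Code.rv (C : Code Ω V d) (L : List Atom) : Ω → List V :=
  fun ω => L.map fun a => C.atomRV a ω

/-- Joint entropy of a tuple of basic random variables. -/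
def Code.HL (C : Code Ω V d) (L : List Atom) : ℝ := H C.p (C.rv L)

/-- Conditional entropy `H(L₁ | L₂)`. -/
def Code.CH (C : Code Ω V d) (L₁ L₂ : List Atom) : ℝ := C.HL (L₁ ++ L₂) - C.HL L₂

/-- Mutual information `I(L₁ ; L₂)`. -/
def Code.MI (C : Code Ω V d) (L₁ L₂ : List Atom) : ℝ :=
  C.HL L₁ + C.HL L₂ - C.HL (L₁ ++ L₂)

/-- Relabeling of an atom along a permutation of the storage-node indices. -/
def Atom.perm (π : Equiv.Perm ℕ) : Atom → Atom
  | .M i => .M i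
  | .K => .K
  | .W i => .W (π i)
  | .S i j => .S (π i) (π j)

/-- A code is symmetrical if every joint entropy of a tuple of the basic random
variables is invariant under every permutation of the storage-node indices `[1:n]`. -/
def Code.Symmetrical (C : Code Ω V d) : Prop :=
  ∀ π : Equiv.Perm ℕ, (∀ i ∈ Finset.Icc 1 (d + 1), π i ∈ Finset.Icc 1 (d + 1)) →
    ∀ L : List Atom, C.HL (L.map (Atom.perm π)) = C.HL L

/-- The list `[a, a+1, …, b]`. -/
def icc (a b : ℕ) : List ℕ := List.range' a (b + 1 - a)

/-- `W_A` as a list of atoms. -/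
def Ws (A : List ℕ) : List Atom := A.map Atom.W

/-- `M_A` as a list of atoms. -/
def MsL (A : List ℕ) : List Atom := A.map Atom.M

/-- `M^{(m)} = (M_1, …, M_m)`. -/
def Mup (m : ℕ) : List Atom := MsL (icc 1 m)

/-- `S_{B → j}`. -/
def Sto (B : List ℕ) (j : ℕ) : List Atom := B.map fun i => Atom.S i j

/-- `S_{i → B}`. -/
def Sfrom (i : ℕ) (B : List ℕ) : List Atom := B.map fun j => Atom.S i j

/-- `S̄_{→ j} = S_{[j+1:n] → j}` (here `n = d+1`). -/
def SbarTo (d j : ℕ) : List Atom := Sto (icc (j + 1) (d + 1)) j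

/-- `S̄_{→ A}`. -/
def SbarToL (d : ℕ) (A : List ℕ) : List Atom := (A.map (SbarTo d)).flatten

/-- `S̲_{→ j} = S_{[1:j-1] → j}`. -/
def SunderTo (j : ℕ) : List Atom := Sto (icc 1 (j - 1)) j

/-- `S̲_{→ A}`. -/
def SunderToL (A : List ℕ) : List Atom := (A.map SunderTo).flatten

/-- `S_{→ j} = S_{([1:n] ∖ {j}) → j}` (here `n = d+1`). -/
def StoFull (d j : ℕ) : List Atom := Sto ((icc 1 (d + 1)).filter (fun i => i ≠ j)) j

/-- `(S_{→ j} : j ∈ A)`. -/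
def StoFullL (d : ℕ) (A : List ℕ) : List Atom := (A.map (StoFull d)).flatten

/-- `U^{(t,s)} = (W_{[1:t]}, S̄_{→[t+1:s]})`. -/
def U (d t s : ℕ) : List Atom := Ws (icc 1 t) ++ SbarToL d (icc (t + 1) s)

/-- Node regeneration: each `W j` is a deterministic function of `S_{→ j}`. -/
def Code.NodeRegen (C : Code Ω V d) : Prop :=
  ∀ j ∈ Finset.Icc 1 (d + 1), IsFuncOf (C.W j) (C.rv (StoFull d j))

/-- Message recovery for parameter `ℓ`: `M j` is constant for `j ∈ [1:ℓ]`, and for every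
`A ⊆ [1:n]` with `|A| ∈ [ℓ+1:d]`, `M_{|A|}` is a deterministic function of `W_A`. -/
def Code.MsgRecovery (C : Code Ω V d) (ℓ : ℕ) : Prop :=
  (∀ j ∈ Finset.Icc 1 ℓ, ∃ c : V, ∀ ω, C.M j ω = c) ∧
  ∀ A : Finset ℕ, A ⊆ Finset.Icc 1 (d + 1) → A.card ∈ Finset.Icc (ℓ + 1) d →
    IsFuncOf (C.M A.card) (C.rv (Ws (A.sort (· ≤ ·))))

/-- Repair secrecy for parameters `ℓ₁, ℓ₂`: for all disjoint `E₁, E₂ ⊆ [1:n]` with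
`|E₁| = ℓ₁`, `|E₂| = ℓ₂`, the messages `M_{ℓ+1}, …, M_d` are independent of
`((W_i : i ∈ E₁), (S_{→j} : j ∈ E₂))`, where `ℓ = ℓ₁ + ℓ₂`. -/
def Code.RepairSecrecy (C : Code Ω V d) (ℓ₁ ℓ₂ : ℕ) : Prop :=
  ∀ E₁ E₂ : Finset ℕ, E₁ ⊆ Finset.Icc 1 (d + 1) → E₂ ⊆ Finset.Icc 1 (d + 1) →
    Disjoint E₁ E₂ → E₁.card = ℓ₁ → E₂.card = ℓ₂ →
    C.MI (MsL (icc (ℓ₁ + ℓ₂ + 1) d))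
      (Ws (E₁.sort (· ≤ ·)) ++ StoFullL d (E₂.sort (· ≤ ·))) = 0

/-- `T_{d,k,ℓ} = Σ_{t=ℓ+1}^{k} (d+1−t)`, as a real number. -/
def T (d k ℓ : ℕ) : ℝ := ∑ t ∈ Finset.Icc (ℓ + 1) k, ((d : ℝ) + 1 - (t : ℝ))


/-- Entropy only depends on the partition of the sample space induced by the variable. -/
lemma H_congr (p : Ω → ℝ) {α β : Type*} {X : Ω → α} {Y : Ω → β}
    (h : ∀ ω ω', X ω = X ω' ↔ Y ω = Y ω') : H p X = H p Y := by
  simp only [H, pm, h]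

lemma le_pm_self {p : Ω → ℝ} (hp : ∀ ω, 0 ≤ p ω) {α : Type*} (X : Ω → α) (ω : Ω) :
    p ω ≤ pm p X (X ω) :=
  Finset.single_le_sum (f := p) (fun i _ => hp i) (by simp)

lemma pm_nonneg {p : Ω → ℝ} (hp : ∀ ω, 0 ≤ p ω) {α : Type*} (X : Ω → α) (x : α) :
    0 ≤ pm p X x :=
  Finset.sum_nonneg fun i _ => hp i

lemma pm_eq_sum_ite (p : Ω → ℝ) {α : Type*} (X : Ω → α) (x : α) :
    pm p X x = ∑ ω, if X ω = x then p ω else 0 := by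
  rw [pm, Finset.sum_filter]

/-- The product of the conditional laws of `X` and `Y` given `Z`, averaged over the law of `Z`,
has total mass at most one on the support of `(X, Y, Z)`. -/
lemma sum_mul_pm_div_le_one {p : Ω → ℝ} (hp : ∀ ω, 0 ≤ p ω) (hs : ∑ ω, p ω = 1)
    {α β γ : Type*} (X : Ω → α) (Y : Ω → β) (Z : Ω → γ) :
    ∑ ω, p ω * (pm p (fun ω => (X ω, Z ω)) (X ω, Z ω) *
      pm p (fun ω => (Y ω, Z ω)) (Y ω, Z ω) /
      (pm p Z (Z ω) * pm p (fun ω => (X ω, Y ω, Z ω)) (X ω, Y ω, Z ω))) ≤ 1 := by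
  set q : Ω → ℝ := fun ω => pm p (fun ω => (X ω, Y ω, Z ω)) (X ω, Y ω, Z ω)
  set r : Ω → ℝ := fun ω => pm p Z (Z ω)
  have hr0 : ∀ ω, 0 ≤ r ω := fun ω => pm_nonneg hp Z _
  have inner : ∀ ω₁ ω₂, (∑ ω, if X ω₁ = X ω ∧ Z ω₁ = Z ω ∧ Y ω₂ = Y ω ∧ Z ω₂ = Z ω then
      p ω / (r ω * q ω) else 0) ≤ if Z ω₂ = Z ω₁ then 1 / r ω₁ else 0 := by
    intro ω₁ ω₂
    by_cases hne : ∃ ω₀, X ω₁ = X ω₀ ∧ Z ω₁ = Z ω₀ ∧ Y ω₂ = Y ω₀ ∧ Z ω₂ = Z ω₀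
    · obtain ⟨ω₀, hx, hz, hy, hz'⟩ := hne
      have key : ∀ ω, (if X ω₁ = X ω ∧ Z ω₁ = Z ω ∧ Y ω₂ = Y ω ∧ Z ω₂ = Z ω then
          p ω / (r ω * q ω) else 0) =
          (if (X ω, Y ω, Z ω) = (X ω₀, Y ω₀, Z ω₀) then p ω else 0) / (r ω₁ * q ω₀) := by
        intro ω
        by_cases h : (X ω, Y ω, Z ω) = (X ω₀, Y ω₀, Z ω₀)
        · have h' := h
          simp only [Prod.mk.injEq] at h'
          obtain ⟨h1, h2, h3⟩ := h'
          have e1 : r ω = r ω₁ := by simp only [r, h3, hz]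
          have e2 : q ω = q ω₀ := by simp only [q, h1, h2, h3]
          rw [if_pos h, if_pos ⟨hx.trans h1.symm, hz.trans h3.symm, hy.trans h2.symm,
            hz'.trans h3.symm⟩, e1, e2]
        · rw [if_neg h, if_neg, zero_div]
          rintro ⟨h1, h2, h3, -⟩
          exact h (by rw [← h1, ← h2, ← h3, hx, hz, hy])
      have hq : q ω₀ = ∑ ω, if (X ω, Y ω, Z ω) = (X ω₀, Y ω₀, Z ω₀) then p ω else 0 :=
        (pm_eq_sum_ite _ _ _).trans (by congr!)
      rw [Finset.sum_congr rfl fun ω _ => key ω, ← Finset.sum_div, ← hq, if_pos (hz'.trans hz.symm), mul_comm, ← div_div]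
      exact div_le_div_of_nonneg_right (div_self_le_one _) (hr0 _)
    · rw [Finset.sum_eq_zero fun ω _ => if_neg fun h => hne ⟨ω, h⟩]
      split_ifs
      · exact one_div_nonneg.2 (hr0 _)
      · exact le_rfl
  calc _ = ∑ ω, ∑ ω₁, ∑ ω₂, p ω₁ * p ω₂ *
        (if X ω₁ = X ω ∧ Z ω₁ = Z ω ∧ Y ω₂ = Y ω ∧ Z ω₂ = Z ω then
          p ω / (r ω * q ω) else 0) := by
        refine Finset.sum_congr rfl fun ω _ => ?_
        rw [pm_eq_sum_ite, pm_eq_sum_ite, Finset.sum_mul_sum, Finset.sum_div, Finset.mul_sum]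
        refine Finset.sum_congr rfl fun ω₁ _ => ?_
        rw [Finset.sum_div, Finset.mul_sum]
        refine Finset.sum_congr rfl fun ω₂ _ => ?_
        simp only [Prod.mk.injEq]
        change p ω * (_ / (r ω * q ω)) = _
        by_cases h1 : X ω₁ = X ω ∧ Z ω₁ = Z ω
        · by_cases h2 : Y ω₂ = Y ω ∧ Z ω₂ = Z ω
          · rw [if_pos h1, if_pos h2, if_pos ⟨h1.1, h1.2, h2⟩]
            ring
          · rw [if_neg h2, if_neg fun h : X ω₁ = X ω ∧ Z ω₁ = Z ω ∧ Y ω₂ = Y ω ∧ Z ω₂ = Z ω => h2 h.2.2]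
            simp
        · rw [if_neg h1, if_neg fun h : X ω₁ = X ω ∧ Z ω₁ = Z ω ∧ Y ω₂ = Y ω ∧ Z ω₂ = Z ω =>
            h1 ⟨h.1, h.2.1⟩]
          simp
    _ = ∑ ω₁, ∑ ω₂, p ω₁ * p ω₂ *
        ∑ ω, (if X ω₁ = X ω ∧ Z ω₁ = Z ω ∧ Y ω₂ = Y ω ∧ Z ω₂ = Z ω then
          p ω / (r ω * q ω) else 0) := by
        rw [Finset.sum_comm]
        refine Finset.sum_congr rfl fun ω₁ _ => ?_
        rw [Finset.sum_comm]
        exact Finset.sum_congr rfl fun ω₂ _ => (Finset.mul_sum _ _ _).symm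
    _ ≤ ∑ ω₁, ∑ ω₂, p ω₁ * p ω₂ * (if Z ω₂ = Z ω₁ then 1 / r ω₁ else 0) :=
        Finset.sum_le_sum fun ω₁ _ => Finset.sum_le_sum fun ω₂ _ =>
          mul_le_mul_of_nonneg_left (inner ω₁ ω₂) (mul_nonneg (hp _) (hp _))
    _ = ∑ ω₁, p ω₁ * (r ω₁ / r ω₁) := by
        refine Finset.sum_congr rfl fun ω₁ _ => ?_
        have e : r ω₁ = ∑ ω₂, if Z ω₂ = Z ω₁ then p ω₂ else 0 := pm_eq_sum_ite _ _ _
        have e' : r ω₁ / r ω₁ = (∑ ω₂, if Z ω₂ = Z ω₁ then p ω₂ else 0) * (1 / r ω₁) := by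
          rw [← e, ← div_eq_mul_one_div]
        rw [e', Finset.sum_mul, Finset.mul_sum]
        refine Finset.sum_congr rfl fun ω₂ _ => ?_
        split_ifs <;> ring
    _ ≤ ∑ ω₁, p ω₁ :=
        Finset.sum_le_sum fun ω₁ _ => mul_le_of_le_one_right (hp _) (div_self_le_one _)
    _ = 1 := hs

/-- Submodularity of Shannon entropy. -/
lemma H_submodular {p : Ω → ℝ} (hp : ∀ ω, 0 ≤ p ω) (hs : ∑ ω, p ω = 1)
    {α β γ : Type*} (X : Ω → α) (Y : Ω → β) (Z : Ω → γ) :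
    H p (fun ω => (X ω, Y ω, Z ω)) + H p Z ≤
      H p (fun ω => (X ω, Z ω)) + H p (fun ω => (Y ω, Z ω)) := by
  have hsum := sum_mul_pm_div_le_one hp hs X Y Z
  have hterm : ∀ ω, p ω * Real.log (pm p (fun ω => (X ω, Z ω)) (X ω, Z ω)) +
      p ω * Real.log (pm p (fun ω => (Y ω, Z ω)) (Y ω, Z ω)) -
      p ω * Real.log (pm p Z (Z ω)) -
      p ω * Real.log (pm p (fun ω => (X ω, Y ω, Z ω)) (X ω, Y ω, Z ω)) ≤
      p ω * (pm p (fun ω => (X ω, Z ω)) (X ω, Z ω) *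
        pm p (fun ω => (Y ω, Z ω)) (Y ω, Z ω) /
        (pm p Z (Z ω) * pm p (fun ω => (X ω, Y ω, Z ω)) (X ω, Y ω, Z ω))) - p ω := by
    intro ω
    rcases (hp ω).eq_or_lt with h0 | h0
    · simp [← h0]
    have h1 := h0.trans_le (le_pm_self hp (fun ω => (X ω, Z ω)) ω)
    have h2 := h0.trans_le (le_pm_self hp (fun ω => (Y ω, Z ω)) ω)
    have h3 := h0.trans_le (le_pm_self hp Z ω)
    have h4 := h0.trans_le (le_pm_self hp (fun ω => (X ω, Y ω, Z ω)) ω)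
    have hlog := Real.log_le_sub_one_of_pos (div_pos (mul_pos h1 h2) (mul_pos h3 h4))
    rw [Real.log_div (mul_pos h1 h2).ne' (mul_pos h3 h4).ne', Real.log_mul h1.ne' h2.ne',
      Real.log_mul h3.ne' h4.ne'] at hlog
    have := mul_le_mul_of_nonneg_left hlog h0.le
    linarith
  have htot := Finset.sum_le_sum fun ω (_ : ω ∈ Finset.univ) => hterm ω
  simp only [Finset.sum_sub_distrib, Finset.sum_add_distrib] at htot
  simp only [H]
  linarith

namespace Code

variable (C : Code Ω V d)

lemma rv_eq_iff (L : List Atom) (ω ω' : Ω) :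
    C.rv L ω = C.rv L ω' ↔ ∀ a ∈ L, C.atomRV a ω = C.atomRV a ω' := by
  simp [rv]

/-- The joint entropy of a tuple only depends on the set of its entries. -/
lemma HL_congr {L L' : List Atom} (h : ∀ a, a ∈ L ↔ a ∈ L') : C.HL L = C.HL L' :=
  H_congr _ fun ω ω' => by simp only [rv_eq_iff, h]

lemma HL_submodular (A B D : List Atom) :
    C.HL (A ++ (B ++ D)) + C.HL D ≤ C.HL (A ++ D) + C.HL (B ++ D) := by
  have key := H_submodular C.p_nonneg C.p_sum (C.rv A) (C.rv B) (C.rv D)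
  have h1 : C.HL (A ++ (B ++ D)) = H C.p fun ω => (C.rv A ω, C.rv B ω, C.rv D ω) :=
    H_congr _ fun ω ω' => by
      simp only [Prod.mk.injEq, rv_eq_iff, List.mem_append, or_imp, forall_and]
  have h2 (E : List Atom) : C.HL (E ++ D) = H C.p fun ω => (C.rv E ω, C.rv D ω) :=
    H_congr _ fun ω ω' => by
      simp only [Prod.mk.injEq, rv_eq_iff, List.mem_append, or_imp, forall_and]
  rw [h1, h2, h2]
  exact key

/-- Conditioning on more variables decreases the conditional entropy. -/
lemma HL_cons_sub_le_of_subset (a : Atom) {D E : List Atom} (h : D ⊆ E) :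
    C.HL (a :: E) - C.HL E ≤ C.HL (a :: D) - C.HL D := by
  have key := C.HL_submodular [a] E D
  have h1 : C.HL (E ++ D) = C.HL E := C.HL_congr fun b => by
    simpa using fun hb => h hb
  have h2 : C.HL ([a] ++ (E ++ D)) = C.HL (a :: E) := C.HL_congr fun b => by
    have := @h b
    simp only [List.singleton_append, List.mem_cons, List.mem_append]
    tauto
  rw [h1, h2] at key
  simp only [List.singleton_append] at key
  linarith

lemma HL_append_sub_le (B D : List Atom) (c : ℝ)
    (h : ∀ a ∈ B, C.HL (a :: D) - C.HL D ≤ c) :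
    C.HL (B ++ D) - C.HL D ≤ B.length * c := by
  induction B with
  | nil => simp
  | cons a B ih =>
    have h1 := ih fun b hb => h b (List.mem_cons_of_mem _ hb)
    have h2 := h a List.mem_cons_self
    have h3 := C.HL_cons_sub_le_of_subset a (List.subset_append_right B D)
    simp only [List.cons_append, List.length_cons, Nat.cast_add, Nat.cast_one]
    linarith

lemma HL_nil : C.HL [] = 0 := by
  simp [HL, H, pm, rv, C.p_sum]

end Code

lemma mem_icc {a b x : ℕ} : x ∈ icc a b ↔ a ≤ x ∧ x ≤ b := by
  simp only [icc, List.mem_range'_1]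
  omega

lemma mem_Sfrom {i : ℕ} {A : List ℕ} {x : Atom} :
    x ∈ Sfrom i A ↔ ∃ j ∈ A, Atom.S i j = x := by
  simp [Sfrom]

/-- The involution of `ℕ` exchanging `[1:a]` and `[a+1:2a]`. -/
def blockSwap (a : ℕ) : Equiv.Perm ℕ :=
  Function.Involutive.toPerm
    (fun x => if 1 ≤ x ∧ x ≤ a then x + a else if a < x ∧ x ≤ 2 * a then x - a else x) (by
      intro x
      dsimp only
      split_ifs <;> omega)

lemma blockSwap_apply (a x : ℕ) : blockSwap a x =
    if 1 ≤ x ∧ x ≤ a then x + a else if a < x ∧ x ≤ 2 * a then x - a else x := rfl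

namespace Code

variable {C : Code Ω V d}

lemma Symmetrical.HL_Sfrom_swap (hsym : C.Symmetrical) {i a k : ℕ} (hk : a + k + 2 < i)
    (hi : i ≤ d + 1) :
    C.HL (Atom.S i (a + k + 2) :: Sfrom i (icc (a + 1) (a + k))) =
      C.HL (Atom.S i (a + k + 1) :: Sfrom i (icc (a + 1) (a + k))) := by
  have hfix : ∀ x, x ≠ a + k + 1 → x ≠ a + k + 2 →
      Equiv.swap (a + k + 1) (a + k + 2) x = x := fun x => Equiv.swap_apply_of_ne_of_ne
  rw [← hsym (Equiv.swap (a + k + 1) (a + k + 2)) ?_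
    (Atom.S i (a + k + 1) :: Sfrom i (icc (a + 1) (a + k)))]
  · congr 1
    simp only [Sfrom, List.map_cons, List.map_map, Atom.perm, Equiv.swap_apply_left]
    rw [hfix i (by omega) (by omega)]
    congr 1
    refine List.map_congr_left fun j hj => ?_
    rw [mem_icc] at hj
    simp only [Function.comp, Atom.perm]
    rw [hfix i (by omega) (by omega), hfix j (by omega) (by omega)]
  · intro x hx
    simp only [Finset.mem_Icc, Equiv.swap_apply_def] at hx ⊢
    split_ifs <;> omega

lemma Symmetrical.HL_Sfrom_shift (hsym : C.Symmetrical) {i a : ℕ} (ha : 2 * a + 1 < i)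
    (hi : i ≤ d + 1) :
    C.HL (Sfrom (a + 1) (icc 1 a)) = C.HL (Sfrom i (icc (a + 1) (a + a))) := by
  rw [← hsym ((blockSwap a).trans (Equiv.swap i (a + 1))) ?_
    (Sfrom i (icc (a + 1) (a + a)))]
  · have himg : ∀ j, (blockSwap a).trans (Equiv.swap i (a + 1)) j =
        if a < j ∧ j ≤ 2 * a then j - a else if j = i then a + 1 else
        (blockSwap a).trans (Equiv.swap i (a + 1)) j := by
      intro j
      split_ifs with h1 h2 <;>
        simp only [Equiv.trans_apply, blockSwap_apply, Equiv.swap_apply_def] <;>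
        split_ifs <;> omega
    refine C.HL_congr fun x => ?_
    simp only [Sfrom, List.map_map, List.mem_map, mem_icc, Function.comp, Atom.perm]
    rw [show (blockSwap a).trans (Equiv.swap i (a + 1)) i = a + 1 by
      rw [himg, if_neg (by omega), if_pos rfl]]
    constructor
    · rintro ⟨j, hj, rfl⟩
      refine ⟨j + a, by omega, ?_⟩
      rw [himg, if_pos (by omega), Nat.add_sub_cancel]
    · rintro ⟨j, hj, rfl⟩
      refine ⟨j - a, by omega, ?_⟩
      rw [himg, if_pos (by omega)]
  · intro x hx
    simp only [Finset.mem_Icc, Equiv.trans_apply, blockSwap_apply, Equiv.swap_apply_def] at hx ⊢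
    split_ifs <;> omega

variable (C) in
lemma HL_Sfrom_succ (i a k : ℕ) :
    C.HL (Sfrom i (icc (a + 1) (a + (k + 1)))) =
      C.HL (Atom.S i (a + k + 1) :: Sfrom i (icc (a + 1) (a + k))) := by
  refine C.HL_congr fun x => ?_
  simp only [List.mem_cons, mem_Sfrom, mem_icc]
  constructor
  · rintro ⟨j, hj, rfl⟩
    by_cases h : j = a + k + 1
    · exact Or.inl (by rw [h])
    · exact Or.inr ⟨j, by omega, rfl⟩
  · rintro (rfl | ⟨j, hj, rfl⟩)
    · exact ⟨_, by omega, rfl⟩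
    · exact ⟨j, by omega, rfl⟩

/-- The entropies of the data sent by one node to `k` others are concave in `k`. -/
lemma Symmetrical.HL_Sfrom_concave (hsym : C.Symmetrical) {i a k : ℕ} (hk : a + k + 2 < i)
    (hi : i ≤ d + 1) :
    C.HL (Sfrom i (icc (a + 1) (a + (k + 1 + 1)))) - C.HL (Sfrom i (icc (a + 1) (a + (k + 1)))) ≤
      C.HL (Sfrom i (icc (a + 1) (a + (k + 1)))) - C.HL (Sfrom i (icc (a + 1) (a + k))) := by
  have hsub : Sfrom i (icc (a + 1) (a + k)) ⊆ Sfrom i (icc (a + 1) (a + (k + 1))) := by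
    intro x
    simp only [mem_Sfrom, mem_icc]
    rintro ⟨j, hj, rfl⟩
    exact ⟨j, by omega, rfl⟩
  have h := C.HL_cons_sub_le_of_subset (Atom.S i (a + k + 2)) hsub
  rw [hsym.HL_Sfrom_swap hk hi, ← C.HL_Sfrom_succ i a k] at h
  rw [C.HL_Sfrom_succ i a (k + 1)]
  exact h

/-- A last increment of the entropy of the data sent by one node is at most the average of the
first `m` increments. -/
lemma Symmetrical.mul_HL_Sfrom_sub_le (hsym : C.Symmetrical) {i a k m : ℕ} (hm : m ≤ k)
    (hk : a + k + 1 < i) (hi : i ≤ d + 1) :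
    m * (C.HL (Sfrom i (icc (a + 1) (a + (k + 1)))) - C.HL (Sfrom i (icc (a + 1) (a + k)))) ≤
      C.HL (Sfrom i (icc (a + 1) (a + m))) := by
  have hanti : ∀ e j, j + e = k →
      C.HL (Sfrom i (icc (a + 1) (a + (k + 1)))) - C.HL (Sfrom i (icc (a + 1) (a + k))) ≤
      C.HL (Sfrom i (icc (a + 1) (a + (j + 1)))) - C.HL (Sfrom i (icc (a + 1) (a + j))) := by
    intro e
    induction e with
    | zero => rintro j rfl; exact le_rfl
    | succ e ih =>
      intro j hj
      exact (ih (j + 1) (by omega)).trans (hsym.HL_Sfrom_concave (by omega) hi)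
  induction m with
  | zero => simp [icc, Sfrom, HL_nil]
  | succ m ih =>
    have h1 := ih (by omega)
    have h2 := hanti (k - m) m (by omega)
    push_cast
    linarith

end Code

theorem statement12 {Ω V : Type} [Fintype Ω] {d : ℕ} (hd : 2 ≤ d)
    {ℓ₁ ℓ₂ ℓ : ℕ} (hℓdef : ℓ = ℓ₁ + ℓ₂) (hℓd : ℓ < d) (hℓ12 : ℓ₁ ≤ ℓ₂)
    (C : Code Ω V d) (hsym : C.Symmetrical) (hregen : C.NodeRegen) :
    C.HL (Sfrom (ℓ₁ + 1) (icc 1 ℓ₁)) + (ℓ₁ : ℝ) / ((d : ℝ) - (ℓ : ℝ)) * C.HL (U d ℓ₁ ℓ)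
      ≥ (ℓ₁ : ℝ) / ((d : ℝ) - (ℓ : ℝ)) * C.HL (U d ℓ₁ (ℓ + 1)) := by
  have hdℓ : (0 : ℝ) < (d : ℝ) - ℓ := sub_pos.2 (by exact_mod_cast hℓd)
  have hU : C.HL (U d ℓ₁ (ℓ + 1)) = C.HL (SbarTo d (ℓ + 1) ++ U d ℓ₁ ℓ) := by
    refine C.HL_congr fun x => ?_
    simp only [U, SbarToL, List.mem_append, List.mem_flatten, List.mem_map,
      exists_exists_and_eq_and, mem_icc]
    constructor
    · rintro (h | ⟨j, hj, hx⟩)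
      · exact Or.inr (Or.inl h)
      · by_cases h : j = ℓ + 1
        · exact Or.inl (h ▸ hx)
        · exact Or.inr (Or.inr ⟨j, by omega, hx⟩)
    · rintro (h | h | ⟨j, hj, hx⟩)
      · exact Or.inr ⟨ℓ + 1, by omega, h⟩
      · exact Or.inl h
      · exact Or.inr ⟨j, by omega, hx⟩
  have hmul : (ℓ₁ : ℝ) * (C.HL (U d ℓ₁ (ℓ + 1)) - C.HL (U d ℓ₁ ℓ)) ≤
      ((d : ℝ) - ℓ) * C.HL (Sfrom (ℓ₁ + 1) (icc 1 ℓ₁)) := by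
    rcases Nat.eq_zero_or_pos ℓ₁ with h0 | hpos
    · subst h0
      simp [icc, Sfrom, Code.HL_nil]
    have hℓ₁ : (0 : ℝ) < ℓ₁ := by exact_mod_cast hpos
    have hlen : ((SbarTo d (ℓ + 1)).length : ℝ) = (d : ℝ) - ℓ := by
      rw [← Nat.cast_sub hℓd.le]
      simp only [SbarTo, Sto, icc, List.length_map, List.length_range']
      congr 1
      omega
    have hbound := C.HL_append_sub_le (SbarTo d (ℓ + 1)) (U d ℓ₁ ℓ)
      (C.HL (Sfrom (ℓ₁ + 1) (icc 1 ℓ₁)) / ℓ₁) (by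
        intro x hx
        simp only [SbarTo, Sto, List.mem_map, mem_icc] at hx
        obtain ⟨i, hi, rfl⟩ := hx
        have hsub : Sfrom i (icc (ℓ₁ + 1) (ℓ₁ + ℓ₂)) ⊆ U d ℓ₁ ℓ := by
          intro x hx
          simp only [mem_Sfrom, mem_icc] at hx
          obtain ⟨j, hj, rfl⟩ := hx
          simp only [U, SbarToL, SbarTo, Sto, List.mem_append, List.mem_flatten, List.mem_map,
            exists_exists_and_eq_and, mem_icc]
          exact Or.inr ⟨j, by omega, i, by omega, rfl⟩
        have h1 := C.HL_cons_sub_le_of_subset (Atom.S i (ℓ + 1)) hsub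
        have h2 := hsym.mul_HL_Sfrom_sub_le (i := i) (a := ℓ₁) hℓ12 (by omega) (by omega)
        rw [← hsym.HL_Sfrom_shift (by omega) (by omega), C.HL_Sfrom_succ, ← hℓdef] at h2
        rw [← hℓdef] at h1
        rw [le_div_iff₀ hℓ₁]
        nlinarith)
    rw [hlen, ← hU, mul_div_assoc', le_div_iff₀ hℓ₁] at hbound
    linarith
  have hdiv : (ℓ₁ : ℝ) / ((d : ℝ) - ℓ) * (C.HL (U d ℓ₁ (ℓ + 1)) - C.HL (U d ℓ₁ ℓ)) ≤
      C.HL (Sfrom (ℓ₁ + 1) (icc 1 ℓ₁)) := by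
    rw [div_mul_eq_mul_div, div_le_iff₀ hdℓ]
    linarith
  linarith

end

end MDCSR
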